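/- Let (X,d,T) be a topological dynamical system with continuous Ξ: M(X) → Y and φ ∈ C(X,ℝ). If K' ⊂ Y is a closed subset, then P({x ∈ X : A(Ξ L_n x) ∩ K' ≠ ∅}, φ) ≤ sup{ Λ(y,φ) : y ∈ K' }, where Λ(y,φ) = sup{h(T,μ)+∫φdμ : μ ∈ M(X,T), Ξμ = y} for y ∈ Ξ(M(X,T)) and −∞ otherwise. -/

import Mathlib

open MeasureTheory Filter Topology Set
open scoped ENNReal

noncomputable section

/-- Birkhoff sum `S_m φ(x) = Σ_{i=0}^{m-1} φ(T^i x)`. -/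
def birkhoffS {X : Type*} (T : X → X) (φ : X → ℝ) (m : ℕ) (x : X) : ℝ :=
  ∑ i ∈ Finset.range m, φ (T^[i] x)

/-- Bowen ball `B_m(x,ε) = {y : max_{0 ≤ i < m} D(T^i x, T^i y) ≤ ε}`, with respect
to a distance function `D`. -/
def bowenBallD {X : Type*} (D : X → X → ℝ) (T : X → X) (x : X) (m : ℕ) (ε : ℝ) : Set X :=
  {y | ∀ i < m, D (T^[i] x) (T^[i] y) ≤ ε}

/-- `C` is an admissible (finite or countable) cover of `Z` by Bowen balls
`B_m(x,ε)` with `m ≥ n`. -/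
def covOK {X : Type*} (D : X → X → ℝ) (T : X → X) (Z : Set X) (n : ℕ) (ε : ℝ)
    (C : Set (X × ℕ)) : Prop :=
  C.Countable ∧ (∀ p ∈ C, n ≤ p.2) ∧ Z ⊆ ⋃ p ∈ C, bowenBallD D T p.1 p.2 ε

/-- `M(Z,t,φ,n,ε) = inf_C Σ exp(-t m + sup_{y ∈ B_m(x,ε)} S_m φ(y))`. -/
def Mpre {X : Type*} (D : X → X → ℝ) (T : X → X) (Z : Set X) (t : ℝ) (φ : X → ℝ)
    (n : ℕ) (ε : ℝ) : ℝ≥0∞ :=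
  ⨅ (C : Set (X × ℕ)) (_ : covOK D T Z n ε C),
    ∑' p : C, ENNReal.ofReal
      (Real.exp (-t * ((p : X × ℕ).2 : ℝ) +
        sSup (birkhoffS T φ (p : X × ℕ).2 '' bowenBallD D T (p : X × ℕ).1 (p : X × ℕ).2 ε)))

/-- `M(Z,t,φ,ε) = lim_n M(Z,t,φ,n,ε)` (the quantity is nondecreasing in `n`). -/
def Mlim {X : Type*} (D : X → X → ℝ) (T : X → X) (Z : Set X) (t : ℝ) (φ : X → ℝ)
    (ε : ℝ) : ℝ≥0∞ :=
  ⨆ n : ℕ, Mpre D T Z t φ n ε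

/-- `P(Z,φ,ε)`: the critical value of `t ↦ M(Z,t,φ,ε)`. -/
def pressAt {X : Type*} (D : X → X → ℝ) (T : X → X) (Z : Set X) (φ : X → ℝ)
    (ε : ℝ) : EReal :=
  sInf {s : EReal | ∃ t : ℝ, s = (t : EReal) ∧ Mlim D T Z t φ ε = 0}

/-- The Pesin–Pitskel topological pressure `P(Z,φ) = lim_{ε → 0⁺} P(Z,φ,ε)`
of an arbitrary subset `Z`, with respect to a distance function `D`. -/
def pressD {X : Type*} (D : X → X → ℝ) (T : X → X) (Z : Set X) (φ : X → ℝ) : EReal :=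
  limsup (fun ε : ℝ => pressAt D T Z φ ε) (𝓝[>] 0)

/-- Topological pressure of a subset of a metric space. -/
def pressure {X : Type*} [MetricSpace X] (T : X → X) (Z : Set X) (φ : X → ℝ) : EReal :=
  pressD (fun a b => dist a b) T Z φ

/-- `N(Z,t,ψ,n,ε) = inf_C Σ exp(-t · sup_{y ∈ B_m(x,ε)} S_m ψ(y))`
(the BS-dimension Carathéodory sum). -/
def Npre {X : Type*} (D : X → X → ℝ) (T : X → X) (Z : Set X) (t : ℝ) (ψ : X → ℝ)
    (n : ℕ) (ε : ℝ) : ℝ≥0∞ :=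
  ⨅ (C : Set (X × ℕ)) (_ : covOK D T Z n ε C),
    ∑' p : C, ENNReal.ofReal
      (Real.exp (-t *
        sSup (birkhoffS T ψ (p : X × ℕ).2 '' bowenBallD D T (p : X × ℕ).1 (p : X × ℕ).2 ε)))

/-- `BS(Z,ψ,ε)`: critical value of `t ↦ lim_n N(Z,t,ψ,n,ε)`. -/
def BSat {X : Type*} (D : X → X → ℝ) (T : X → X) (Z : Set X) (ψ : X → ℝ)
    (ε : ℝ) : EReal :=
  sInf {s : EReal | ∃ t : ℝ, s = (t : EReal) ∧ (⨆ n : ℕ, Npre D T Z t ψ n ε) = 0}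

/-- The BS-dimension `BS(Z,ψ) = lim_{ε → 0⁺} BS(Z,ψ,ε)` of Barreira–Schmeling. -/
def BSdimD {X : Type*} (D : X → X → ℝ) (T : X → X) (Z : Set X) (ψ : X → ℝ) : EReal :=
  limsup (fun ε : ℝ => BSat D T Z ψ ε) (𝓝[>] 0)

/-- BS-dimension in a metric space. -/
def BSdim {X : Type*} [MetricSpace X] (T : X → X) (Z : Set X) (ψ : X → ℝ) : EReal :=
  BSdimD (fun a b => dist a b) T Z ψ

end
open MeasureTheory Filter Topology Set
open scoped ENNReal

noncomputable section

/-- The `n`-th (here: `(n+1)`-st) empirical measure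
`L_{n+1} x = (1/(n+1)) Σ_{k=0}^{n} δ_{T^k x}` as a Borel probability measure. -/
noncomputable def empPM {X : Type*} [MeasurableSpace X] (T : X → X) (x : X) (n : ℕ) :
    ProbabilityMeasure X :=
  ⟨((n + 1 : ℝ≥0∞))⁻¹ • ∑ k ∈ Finset.range (n + 1), Measure.dirac (T^[k] x), by
    constructor
    rw [Measure.smul_apply, Measure.coe_finset_sum, Finset.sum_apply]
    simp only [measure_univ, Finset.sum_const, Finset.card_range, nsmul_eq_mul, mul_one]
    rw [smul_eq_mul]
    have h1 : ((n : ℝ≥0∞) + 1) ≠ 0 := by simp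
    have h2 : ((n : ℝ≥0∞) + 1) ≠ ⊤ := by simp [ENNReal.add_ne_top]
    rw [show ((n + 1 : ℕ) : ℝ≥0∞) = (n : ℝ≥0∞) + 1 by push_cast; ring]
    exact ENNReal.inv_mul_cancel h1 h2⟩

/-- The set of accumulation (cluster) points of a sequence. -/
def accPts {Y : Type*} [TopologicalSpace Y] (u : ℕ → Y) : Set Y :=
  {p | MapClusterPt p atTop u}

/-- `μ` is a `T`-invariant probability measure. -/
def InvMeas {X : Type*} [MeasurableSpace X] (T : X → X) (μ : ProbabilityMeasure X) : Prop :=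
  (μ : Measure X).map T = (μ : Measure X)

/-- Entropy `H_μ` of the refined partition `⋁_{j=0}^{m-1} T^{-j} P` determined by a
finite measurable partition coded by `P : X → Fin k`. -/
noncomputable def partitionH {X : Type*} [MeasurableSpace X] (T : X → X) (μ : Measure X)
    {k : ℕ} (P : X → Fin k) (m : ℕ) : ℝ :=
  ∑ s : Fin m → Fin k,
    Real.negMulLog ((μ {x | ∀ j : Fin m, P (T^[(j : ℕ)] x) = s j}).toReal)

/-- Kolmogorov–Sinai (measure-theoretic) entropy `h(T,μ)`: the supremum over finite
measurable partitions of `lim_n (1/n) H_μ(⋁_{j<n} T^{-j}P)`; by subadditivity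
(Fekete) the limit equals the infimum. -/
noncomputable def entropyKS {X : Type*} [MeasurableSpace X] (T : X → X) (μ : Measure X) :
    ℝ≥0∞ :=
  ⨆ (k : ℕ) (P : X → Fin k) (_ : Measurable P),
    ⨅ n : ℕ, ENNReal.ofReal (partitionH T μ P (n + 1) / (n + 1))

/-- `Λ(y,φ) = sup { h(T,μ) + ∫ φ dμ : μ ∈ M(X,T), Ξ μ = y }`, with value `⊥ = -∞`
when no invariant measure is mapped to `y` by `Ξ`. -/
noncomputable def Lam {X Y : Type*} [MeasurableSpace X] (T : X → X)
    (Ξ : ProbabilityMeasure X → Y) (φ : X → ℝ) (y : Y) : EReal :=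
  ⨆ (μ : ProbabilityMeasure X) (_ : InvMeas T μ ∧ Ξ μ = y),
    ((entropyKS T (μ : Measure X) : ℝ≥0∞) : EReal) + ((∫ x, φ x ∂(μ : Measure X) : ℝ) : EReal)

end

theorem integral_empPM {X : Type*} [MeasurableSpace X] [MeasurableSingletonClass X]
    (T : X → X) (f : X → ℝ) (x : X) (n : ℕ) :
    ∫ y, f y ∂(empPM T x n : Measure X) =
      ((n : ℝ) + 1)⁻¹ * ∑ k ∈ Finset.range (n + 1), f (T^[k] x) := by
  change ∫ y, f y ∂(((n + 1 : ℝ≥0∞))⁻¹ • ∑ k ∈ Finset.range (n + 1), Measure.dirac (T^[k] x)) = _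
  rw [integral_smul_measure, integral_finsetSum_measure fun i _ => integrable_dirac (by simp)]
  simp only [integral_dirac, smul_eq_mul, ENNReal.toReal_inv]
  norm_cast

theorem isClosed_setOf_invMeas {X : Type*} [MetricSpace X] [MeasurableSpace X] [BorelSpace X]
    {T : X → X} (hT : Continuous T) : IsClosed {μ : ProbabilityMeasure X | InvMeas T μ} := by
  have h : {μ : ProbabilityMeasure X | InvMeas T μ} =
      {μ | μ.map hT.measurable.aemeasurable = μ} := by
    ext μ
    exact (Subtype.ext_iff (a1 := μ.map hT.measurable.aemeasurable) (a2 := μ)).symm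
  rw [h]
  exact isClosed_eq (ProbabilityMeasure.continuous_map hT) continuous_id

/-- Limits of empirical measures are invariant (Krylov–Bogolyubov). -/
theorem invMeas_of_tendsto_empPM {X : Type*} [MetricSpace X] [CompactSpace X]
    [MeasurableSpace X] [BorelSpace X] {T : X → X} (hT : Continuous T) {x : X}
    {G : Filter ℕ} [G.NeBot] (hG : G ≤ atTop) {μ : ProbabilityMeasure X}
    (h : Tendsto (empPM T x) G (𝓝 μ)) : InvMeas T μ := by
  have : IsProbabilityMeasure ((μ : Measure X).map T) :=
    Measure.isProbabilityMeasure_map hT.measurable.aemeasurable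
  refine ext_of_forall_integral_eq_of_IsFiniteMeasure fun f => ?_
  rw [integral_map hT.measurable.aemeasurable f.continuous.aestronglyMeasurable]
  have h1 := ((ProbabilityMeasure.continuous_integral_boundedContinuousFunction f).tendsto μ).comp h
  have h2 := ((ProbabilityMeasure.continuous_integral_boundedContinuousFunction
    (f.compContinuous ⟨T, hT⟩)).tendsto μ).comp h
  have h3 : Tendsto (fun n : ℕ => ((n : ℝ) + 1)⁻¹ * (f (T^[n + 1] x) - f x)) atTop (𝓝 0) := by
    refine Tendsto.zero_mul_isBoundedUnder_le ?_ ?_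
    · simpa using tendsto_one_div_add_atTop_nhds_zero_nat (𝕜 := ℝ)
    · refine isBoundedUnder_of ⟨‖f‖ + ‖f‖, fun n => ?_⟩
      exact (norm_sub_le _ _).trans (add_le_add (f.norm_coe_le_norm _) (f.norm_coe_le_norm _))
  refine sub_eq_zero.1 (tendsto_nhds_unique (h2.sub h1) ((h3.mono_left hG).congr fun n => ?_))
  simp only [Function.comp_apply, BoundedContinuousFunction.compContinuous_apply,
    ContinuousMap.coe_mk, integral_empPM, ← mul_sub, ← Finset.sum_sub_distrib,
    ← Function.iterate_succ_apply' T]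
  rw [Finset.sum_range_sub (fun k => f (T^[k] x))]
  rfl

theorem integral_comp_eq_sum_measureReal {X S : Type*} [MeasurableSpace X] [Fintype S]
    [MeasurableSpace S] [MeasurableSingletonClass S] {B : X → S} (hB : Measurable B)
    (μ : Measure X) [IsFiniteMeasure μ] (g : S → ℝ) :
    ∫ x, g (B x) ∂μ = ∑ s, μ.real (B ⁻¹' {s}) * g s := by
  rw [← integral_map (φ := B) hB.aemeasurable (Measurable.of_discrete.aestronglyMeasurable),
    integral_fintype .of_finite]
  simp [Measure.real, Measure.map_apply hB (measurableSet_singleton _)]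

theorem continuousAt_integral_comp_of_ae_locally_const {X S : Type*} [MetricSpace X]
    [MeasurableSpace X] [BorelSpace X] [Fintype S] [MeasurableSpace S]
    [MeasurableSingletonClass S] {B : X → S} (hB : Measurable B) {μ : ProbabilityMeasure X}
    (hloc : ∀ᵐ x ∂(μ : Measure X), ∀ᶠ y in 𝓝 x, B y = B x) (g : S → ℝ) :
    ContinuousAt (fun ν : ProbabilityMeasure X => ∫ x, g (B x) ∂(ν : Measure X)) μ := by
  have hfr : ∀ s, (μ : Measure X) (frontier (B ⁻¹' {s})) = 0 := by
    intro s
    refine measure_eq_zero_iff_ae_notMem.2 (hloc.mono fun x hx' hx => ?_)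
    rw [frontier_eq_closure_inter_closure] at hx
    obtain ⟨y, hy, hys⟩ := ((mem_closure_iff_frequently.1 hx.1).and_eventually hx').exists
    obtain ⟨z, hz, hzs⟩ := ((mem_closure_iff_frequently.1 hx.2).and_eventually hx').exists
    exact hz (hzs.trans (hys.symm.trans hy))
  simp only [ContinuousAt, integral_comp_eq_sum_measureReal hB]
  refine tendsto_finsetSum _ fun s _ => Tendsto.mul_const _ ?_
  exact (ENNReal.tendsto_toReal (measure_ne_top _ _)).comp
    (ProbabilityMeasure.tendsto_measure_of_null_frontier_of_tendsto' tendsto_id (hfr s))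

/-- A compact metric space has finite measurable partitions of arbitrarily small mesh whose
labelling is locally constant almost everywhere. -/
theorem exists_partition_ae_locally_const {X : Type*} [MetricSpace X] [CompactSpace X]
    [MeasurableSpace X] [BorelSpace X] (μ : Measure X) [SFinite μ] {ε : ℝ} (hε : 0 < ε) :
    ∃ (k : ℕ) (P : X → Fin k), Measurable P ∧ (∀ x y, P x = P y → dist x y ≤ ε) ∧
      ∀ᵐ x ∂μ, ∀ᶠ y in 𝓝 x, P y = P x := by
  classical
  choose r hr hfr using fun x : X =>
    exists_null_frontier_thickening μ {x} (show 0 < ε / 2 by linarith)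
  simp only [Metric.thickening_singleton] at hfr
  obtain ⟨t, ht⟩ := isCompact_univ.elim_finite_subcover (fun x : X => Metric.ball x (r x))
    (fun _ => Metric.isOpen_ball)
    (fun x _ => mem_iUnion.2 ⟨x, Metric.mem_ball_self (hr x).1⟩)
  let c : X → (t → Bool) := fun x i => decide (x ∈ Metric.ball (i : X) (r i))
  refine ⟨_, Fintype.equivFin (t → Bool) ∘ c, ?_, fun x y hxy => ?_, ?_⟩
  · refine Measurable.of_discrete.comp (measurable_pi_lambda _ fun i => ?_)
    refine measurable_to_bool ?_
    have : (fun x => c x i) ⁻¹' {true} = Metric.ball (i : X) (r i) := by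
      ext x
      simp [c]
    rw [this]
    exact measurableSet_ball
  · have hc : c x = c y := (Fintype.equivFin _).injective hxy
    obtain ⟨i, hi, hxi⟩ := mem_iUnion₂.1 (ht (mem_univ x))
    have hyi : y ∈ Metric.ball i (r i) := by
      have := congrFun hc ⟨i, hi⟩
      simp only [c] at this
      exact (decide_eq_decide.1 this).1 hxi
    have := dist_triangle_right x y i
    have := (hr i).2
    rw [Metric.mem_ball] at hxi hyi
    linarith
  · have : ∀ᵐ x ∂μ, ∀ i : t, x ∉ frontier (Metric.ball (i : X) (r i)) :=
      ae_all_iff.2 fun i => measure_eq_zero_iff_ae_notMem.1 (hfr i)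
    filter_upwards [this] with x hx
    have hev : ∀ᶠ y in 𝓝 x, ∀ i, c y i = c x i := by
      refine eventually_all.2 fun i => ?_
      simp only [c, decide_eq_decide]
      have hxi := hx i
      rw [frontier_eq_closure_inter_closure] at hxi
      by_cases hm : x ∈ Metric.ball (i : X) (r i)
      · filter_upwards [Metric.isOpen_ball.mem_nhds hm] with y hy using iff_of_true hy hm
      · have hcl : x ∉ closure (Metric.ball (i : X) (r i)) :=
          fun h => hxi ⟨h, subset_closure hm⟩
        filter_upwards [isClosed_closure.isOpen_compl.mem_nhds hcl] with y hy
        exact iff_of_false (fun h => hy (subset_closure h)) hm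
    filter_upwards [hev] with y hy
    exact congrArg (Fintype.equivFin _) (funext hy)

theorem card_filter_prod_ge_mul_le_one {I S : Type*} [Fintype I] [DecidableEq I] [Fintype S]
    {w : S → ℝ} (hw : ∀ s, 0 ≤ w s) (hsum : ∑ s, w s = 1) (c : ℝ)
    [DecidablePred fun f : I → S => c ≤ ∏ i, w (f i)] :
    ((Finset.univ.filter fun f : I → S => c ≤ ∏ i, w (f i)).card : ℝ) * c ≤ 1 := by
  have htot : ∑ f : I → S, ∏ i, w (f i) = 1 := by
    rw [← Fintype.piFinset_univ, Finset.sum_prod_piFinset]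
    simp [hsum]
  calc _ ≤ ∑ f ∈ Finset.univ.filter (fun f : I → S => c ≤ ∏ i, w (f i)), ∏ i, w (f i) := by
        rw [← nsmul_eq_mul]
        exact Finset.card_nsmul_le_sum _ _ _ fun f hf => (Finset.mem_filter.1 hf).2
    _ ≤ ∑ f : I → S, ∏ i, w (f i) :=
        Finset.sum_le_sum_of_subset_of_nonneg (Finset.filter_subset _ _)
          fun f _ _ => Finset.prod_nonneg fun i _ => hw _
    _ = 1 := htot

/-- The `q`-block of symbols of the itinerary of `x` with respect to the labelling `P`. -/
def itinBlock {X : Type*} {k : ℕ} (T : X → X) (P : X → Fin k) (q : ℕ) (x : X) : Fin q → Fin k :=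
  fun l => P (T^[l] x)

theorem measurable_itinBlock {X : Type*} [MeasurableSpace X] {k : ℕ} {T : X → X}
    (hT : Measurable T) {P : X → Fin k} (hP : Measurable P) (q : ℕ) :
    Measurable (itinBlock T P q) :=
  measurable_pi_lambda _ fun l => hP.comp (hT.iterate l)

theorem ae_locally_const_itinBlock {X : Type*} [MetricSpace X] [MeasurableSpace X]
    [BorelSpace X] {k : ℕ} {T : X → X} (hT : Continuous T) {μ : ProbabilityMeasure X}
    (hμ : InvMeas T μ) {P : X → Fin k}
    (hloc : ∀ᵐ x ∂(μ : Measure X), ∀ᶠ y in 𝓝 x, P y = P x) (q : ℕ) :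
    ∀ᵐ x ∂(μ : Measure X), ∀ᶠ y in 𝓝 x, itinBlock T P q y = itinBlock T P q x := by
  have hpres : MeasurePreserving T (μ : Measure X) (μ : Measure X) := ⟨hT.measurable, hμ⟩
  have : ∀ᵐ x ∂(μ : Measure X), ∀ l : Fin q, ∀ᶠ y in 𝓝 (T^[l] x), P y = P (T^[l] x) :=
    ae_all_iff.2 fun l => (hpres.iterate l).quasiMeasurePreserving.ae hloc
  filter_upwards [this] with x hx
  have := eventually_all.2 fun l : Fin q => ((hT.iterate l).tendsto x).eventually (hx l)
  filter_upwards [this] with y hy using funext hy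

/-- Points whose orbit segments have small average code length for the weights `w` on `q`-blocks
are covered by few Bowen balls. -/
theorem exists_finset_bowenBall_cover {X : Type*} [MetricSpace X] {T : X → X} {k q : ℕ}
    (hq : 0 < q) {P : X → Fin k} {ε : ℝ} (hP : ∀ x y, P x = P y → dist x y ≤ ε)
    {w : (Fin q → Fin k) → ℝ} (hw : ∀ s, 0 < w s) (hsum : ∑ s, w s = 1) (m : ℕ) (a : ℝ)
    {G : Set X}
    (hG : ∀ x ∈ G, ∑ i ∈ Finset.range m, -Real.log (w (itinBlock T P q (T^[i] x))) ≤ q * a) :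
    ∃ E : Finset X, (E : Set X) ⊆ G ∧ (E.card : ℝ) ≤ q * (k ^ q * Real.exp a) ∧
      ∀ x ∈ G, ∃ e ∈ E, x ∈ bowenBallD (fun a b => dist a b) T e m ε := by
  classical
  let I : ℕ → Finset ℕ := fun j => (Finset.range m).filter fun i => i % q = j
  let Gj : ℕ → Set X := fun j =>
    {x ∈ G | ∑ i ∈ I j, -Real.log (w (itinBlock T P q (T^[i] x))) ≤ a}
  have key : ∀ j, ∃ E : Finset X, (E : Set X) ⊆ G ∧ (E.card : ℝ) ≤ k ^ q * Real.exp a ∧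
      (j < q → ∀ x ∈ Gj j, ∃ e ∈ E, x ∈ bowenBallD (fun a b => dist a b) T e m ε) := by
    intro j
    let code : X → (Fin q → Fin k) × (I j → (Fin q → Fin k)) := fun x =>
      (itinBlock T P q x, fun i => itinBlock T P q (T^[i] x))
    let good : Finset (I j → (Fin q → Fin k)) :=
      Finset.univ.filter fun f => Real.exp (-a) ≤ ∏ i, w (f i)
    obtain ⟨s, hs, hbij⟩ := exists_subset_bijOn (Gj j) code
    have hfin : s.Finite := hbij.finite_iff_finite.2 (toFinite _)
    refine ⟨hfin.toFinset, ?_, ?_, ?_⟩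
    · rw [hfin.coe_toFinset]
      exact fun x hx => (hs hx).1
    · have hmaps : ∀ x ∈ hfin.toFinset,
          code x ∈ (Finset.univ : Finset (Fin q → Fin k)) ×ˢ good := by
        intro x hx
        have hx' := (hs (hfin.mem_toFinset.1 hx)).2
        refine Finset.mem_product.2 ⟨Finset.mem_univ _, Finset.mem_filter.2 ⟨Finset.mem_univ _, ?_⟩⟩
        have hprod : 0 < ∏ i : I j, w ((code x).2 i) := Finset.prod_pos fun i _ => hw _
        rw [← Real.le_log_iff_exp_le hprod, Real.log_prod fun i _ => (hw _).ne']
        simp only [code]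
        rw [Finset.sum_coe_sort (I j) fun i => Real.log (w (itinBlock T P q (T^[i] x)))]
        rw [Finset.sum_neg_distrib] at hx'
        linarith
      have hcard := Finset.card_le_card_of_injOn code hmaps
        (by rw [hfin.coe_toFinset]; exact hbij.injOn)
      rw [Finset.card_product, Finset.card_univ, Fintype.card_fun, Fintype.card_fin,
        Fintype.card_fin] at hcard
      have hgood : (good.card : ℝ) ≤ Real.exp a := by
        have := card_filter_prod_ge_mul_le_one (I := I j) (fun s => (hw s).le) hsum
          (Real.exp (-a))
        rwa [← le_div_iff₀ (Real.exp_pos _), one_div, ← Real.exp_neg, neg_neg] at this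
      calc (hfin.toFinset.card : ℝ) ≤ ((k ^ q * good.card : ℕ) : ℝ) := by exact_mod_cast hcard
        _ = k ^ q * good.card := by push_cast; ring
        _ ≤ k ^ q * Real.exp a := by gcongr
    · intro hj x hx
      obtain ⟨e, he, hex⟩ := hbij.surjOn (mem_image_of_mem code hx)
      refine ⟨e, hfin.mem_toFinset.2 he, fun i hi => hP _ _ ?_⟩
      have h1 : itinBlock T P q e = itinBlock T P q x := congrArg Prod.fst hex
      have h2 : ∀ i : I j, itinBlock T P q (T^[i] e) = itinBlock T P q (T^[i] x) :=
        fun i => congrFun (congrArg Prod.snd hex) i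
      rcases lt_or_ge i j with hij | hij
      · exact congrFun h1 ⟨i, hij.trans hj⟩
      · have hlt : (i - j) % q < q := Nat.mod_lt _ hq
        have hle : (i - j) % q ≤ i - j := Nat.mod_le _ _
        have hdm := Nat.mod_add_div (i - j) q
        have hi0 : i - (i - j) % q = j + q * ((i - j) / q) := by omega
        have hmem : i - (i - j) % q ∈ I j := by
          refine Finset.mem_filter.2 ⟨Finset.mem_range.2 (by omega), ?_⟩
          rw [hi0, Nat.add_mul_mod_self_left, Nat.mod_eq_of_lt hj]
        have := congrFun (h2 ⟨_, hmem⟩) ⟨(i - j) % q, hlt⟩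
        simp only [itinBlock, ← Function.iterate_add_apply] at this
        rwa [show (i - j) % q + (i - (i - j) % q) = i by omega] at this
  choose E hEG hEcard hEcov using key
  refine ⟨(Finset.range q).biUnion E, ?_, ?_, ?_⟩
  · intro x hx
    obtain ⟨j, -, hj⟩ := Finset.mem_biUnion.1 (Finset.mem_coe.1 hx)
    exact hEG j hj
  · calc (((Finset.range q).biUnion E).card : ℝ) ≤ ∑ j ∈ Finset.range q, ((E j).card : ℝ) := by
          exact_mod_cast Finset.card_biUnion_le
      _ ≤ ∑ j ∈ Finset.range q, (k ^ q * Real.exp a) := Finset.sum_le_sum fun j _ => hEcard j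
      _ = q * (k ^ q * Real.exp a) := by simp
  · intro x hx
    have hfib := Finset.sum_fiberwise_of_maps_to (s := Finset.range m) (t := Finset.range q)
      (g := fun i => i % q) (fun i _ => Finset.mem_range.2 (Nat.mod_lt i hq))
      (fun i => -Real.log (w (itinBlock T P q (T^[i] x))))
    have hxG := hG x hx
    rw [← hfib] at hxG
    obtain ⟨j, hj, hja⟩ := Finset.exists_le_of_sum_le (s := Finset.range q) (g := fun _ => a)
      (Finset.nonempty_range_iff.2 hq.ne') (hxG.trans (by simp))
    obtain ⟨e, he, hxe⟩ := hEcov j (Finset.mem_range.1 hj) x ⟨hx, hja⟩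
    exact ⟨e, Finset.mem_biUnion.2 ⟨j, hj, he⟩, hxe⟩

/-- A probability vector can be smoothed to a positive one whose cross entropy exceeds the entropy
by at most `ρ`. -/
theorem exists_pos_weights_crossEntropy_le {S : Type*} [Fintype S] [Nonempty S] {p : S → ℝ}
    (hp : ∀ s, 0 ≤ p s) (hsum : ∑ s, p s = 1) {ρ : ℝ} (hρ : 0 < ρ) :
    ∃ w : S → ℝ, (∀ s, 0 < w s) ∧ ∑ s, w s = 1 ∧
      ∑ s, p s * -Real.log (w s) ≤ ∑ s, Real.negMulLog (p s) + ρ := by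
  have h1 : Real.exp (-ρ) < 1 := Real.exp_lt_one_iff.2 (by linarith)
  have hN : (0 : ℝ) < Fintype.card S := by exact_mod_cast Fintype.card_pos
  have hpos : 0 < (1 - Real.exp (-ρ)) / Fintype.card S := div_pos (by linarith) hN
  refine ⟨fun s => Real.exp (-ρ) * p s + (1 - Real.exp (-ρ)) / Fintype.card S, fun s => ?_, ?_, ?_⟩
  · exact add_pos_of_nonneg_of_pos (mul_nonneg (Real.exp_pos _).le (hp s)) hpos
  · rw [Finset.sum_add_distrib, ← Finset.mul_sum, hsum, Finset.sum_const, Finset.card_univ,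
      nsmul_eq_mul]
    field_simp
    ring
  · have hρ' : ρ = ∑ s, p s * ρ := by rw [← Finset.sum_mul, hsum, one_mul]
    conv_rhs => rw [hρ']
    rw [← Finset.sum_add_distrib]
    refine Finset.sum_le_sum fun s _ => ?_
    rcases (hp s).eq_or_lt with h0 | h0
    · simp [← h0]
    · have hlog : Real.log (Real.exp (-ρ) * p s) ≤
          Real.log (Real.exp (-ρ) * p s + (1 - Real.exp (-ρ)) / Fintype.card S) :=
        Real.log_le_log (by positivity) (by linarith)
      rw [Real.log_mul (Real.exp_pos _).ne' h0.ne', Real.log_exp] at hlog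
      rw [Real.negMulLog]
      nlinarith

theorem pressAt_le_of_frequently_cover {X : Type*} {D : X → X → ℝ} {T : X → X} {Z : Set X}
    {φ : X → ℝ} {ε C r t : ℝ} (hrt : r < t) (E : ℕ → Finset X)
    (hcov : ∀ x ∈ Z, ∃ᶠ n in atTop, ∃ e ∈ E n, x ∈ bowenBallD D T e (n + 1) ε)
    (hsum : ∀ n, ∑ e ∈ E n, Real.exp (sSup (birkhoffS T φ (n + 1) '' bowenBallD D T e (n + 1) ε)) ≤
      C * Real.exp ((n + 1) * r)) :
    pressAt D T Z φ ε ≤ t := by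
  classical
  refine sInf_le ⟨t, rfl, ?_⟩
  let b : ℕ → ℝ≥0∞ := fun n => ENNReal.ofReal (C * Real.exp ((n + 1) * (r - t)))
  have hb : ∑' n, b n ≠ ∞ := by
    have hs : Summable fun n : ℕ => C * Real.exp ((n + 1) * (r - t)) := by
      have := (Real.summable_exp_nat_mul_iff.2 (sub_neg.2 hrt)).mul_left (C * Real.exp (r - t))
      refine this.congr fun n => ?_
      rw [mul_assoc, ← Real.exp_add]
      ring_nf
    exact hs.tsum_ofReal_ne_top
  refine ENNReal.iSup_eq_zero.2 fun N => le_antisymm ?_ zero_le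
  refine ge_of_tendsto (ENNReal.tendsto_sum_nat_add b hb) ?_
  filter_upwards [eventually_ge_atTop N] with j hj
  let c : ℕ → Finset (X × ℕ) := fun k => (E (k + j)).image fun e => (e, k + j + 1)
  have hc : covOK D T Z N ε (⋃ k, (c k : Set (X × ℕ))) := by
    refine ⟨countable_iUnion fun k => (c k).countable_toSet, fun p hp => ?_, fun x hx => ?_⟩
    · obtain ⟨k, hk⟩ := mem_iUnion.1 hp
      obtain ⟨e, -, rfl⟩ := Finset.mem_image.1 (Finset.mem_coe.1 hk)
      change N ≤ k + j + 1
      omega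
    · obtain ⟨n, hjn, e, he, hxe⟩ := frequently_atTop.1 (hcov x hx) j
      obtain ⟨k, rfl⟩ := Nat.exists_eq_add_of_le' hjn
      exact mem_iUnion₂.2 ⟨(e, k + j + 1), mem_iUnion.2
        ⟨k, Finset.mem_coe.2 (Finset.mem_image_of_mem _ he)⟩, hxe⟩
  refine (iInf₂_le _ hc).trans ?_
  refine (ENNReal.tsum_iUnion_le_tsum (fun p : X × ℕ => ENNReal.ofReal
    (Real.exp (-t * (p.2 : ℝ) + sSup (birkhoffS T φ p.2 '' bowenBallD D T p.1 p.2 ε)))) _).trans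
    (ENNReal.tsum_le_tsum fun k => ?_)
  refine (Finset.tsum_subtype' (c k) fun p : X × ℕ => ENNReal.ofReal (Real.exp (-t * (p.2 : ℝ) +
    sSup (birkhoffS T φ p.2 '' bowenBallD D T p.1 p.2 ε)))).trans_le ?_
  rw [Finset.sum_image fun e _ e' _ h => congrArg Prod.fst h,
    ← ENNReal.ofReal_sum_of_nonneg fun _ _ => (Real.exp_pos _).le]
  refine ENNReal.ofReal_le_ofReal ?_
  simp only [Real.exp_add, ← Finset.mul_sum]
  refine (mul_le_mul_of_nonneg_left (hsum (k + j)) (Real.exp_pos _).le).trans_eq ?_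
  rw [mul_left_comm, ← Real.exp_add]
  push_cast
  ring_nf

/-- Near an invariant measure `μ`, the points with empirical measure close to `μ` are covered by
Bowen balls whose total weight grows at a rate governed by `h(T,μ) + ∫ φ dμ`. -/
theorem exists_nhds_bowenBall_cover {X : Type*} [MetricSpace X] [CompactSpace X]
    [MeasurableSpace X] [BorelSpace X] {T : X → X} (hT : Continuous T) {φ : X → ℝ}
    (hφ : Continuous φ) {μ : ProbabilityMeasure X} (hμ : InvMeas T μ) {s : ℝ}
    (hs : ((entropyKS T (μ : Measure X) : ℝ≥0∞) : EReal) +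
      ((∫ x, φ x ∂(μ : Measure X) : ℝ) : EReal) < s)
    {ε η : ℝ} (hε : 0 < ε) (hosc : ∀ x y, dist x y ≤ ε → φ y ≤ φ x + η) :
    ∃ U ∈ 𝓝 μ, ∃ C : ℝ, ∀ n, ∃ E : Finset X,
      (∀ x, empPM T x n ∈ U → ∃ e ∈ E, x ∈ bowenBallD (fun a b => dist a b) T e (n + 1) ε) ∧
      ∑ e ∈ E, Real.exp (sSup (birkhoffS T φ (n + 1) ''
        bowenBallD (fun a b => dist a b) T e (n + 1) ε)) ≤ C * Real.exp ((n + 1) * (s + η)) := by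
  set J := ∫ x, φ x ∂(μ : Measure X)
  obtain ⟨k, P, hPm, hPε, hloc⟩ := exists_partition_ae_locally_const (μ : Measure X) hε
  have hlt : entropyKS T (μ : Measure X) < ENNReal.ofReal (s - J) := by
    have h1 : ((entropyKS T (μ : Measure X) : ℝ≥0∞) : EReal) < ((s - J : ℝ) : EReal) := by
      rw [EReal.coe_sub]
      exact EReal.lt_sub_iff_add_lt (by simp) (by simp) |>.2 hs
    rw [← EReal.coe_ennreal_lt_coe_ennreal_iff, EReal.coe_ennreal_ofReal]
    exact h1.trans_le (by exact_mod_cast le_max_left _ _)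
  have hle : ⨅ n : ℕ, ENNReal.ofReal (partitionH T (μ : Measure X) P (n + 1) / (n + 1)) ≤
      entropyKS T (μ : Measure X) :=
    le_iSup_of_le k (le_iSup_of_le P (le_iSup_of_le hPm le_rfl))
  obtain ⟨n₀, hn₀⟩ := iInf_lt_iff.1 (hle.trans_lt hlt)
  obtain ⟨hlt', -⟩ := ENNReal.ofReal_lt_ofReal_iff'.1 hn₀
  set q := n₀ + 1 with hq
  set H := partitionH T (μ : Measure X) P q
  have hq1 : (1 : ℝ) ≤ q := by simp [hq]
  have hqpos : 0 < q := Nat.succ_pos _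
  have hlt'' : H / q < s - J := by simpa [hq] using hlt'
  obtain ⟨ρ, hρ, hρs⟩ : ∃ ρ > 0, H / q + 3 * ρ ≤ s - J :=
    ⟨(s - J - H / q) / 3, by linarith, by linarith⟩
  have hBm := measurable_itinBlock hT.measurable hPm q
  have hBloc := ae_locally_const_itinBlock hT hμ hloc q
  let p : (Fin q → Fin k) → ℝ := fun σ => (μ : Measure X).real (itinBlock T P q ⁻¹' {σ})
  have hpint : ∀ g : (Fin q → Fin k) → ℝ,
      ∫ x, g (itinBlock T P q x) ∂(μ : Measure X) = ∑ σ, p σ * g σ :=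
    integral_comp_eq_sum_measureReal hBm _
  have hp1 : ∑ σ, p σ = 1 := by simpa using (hpint fun _ => 1).symm
  have hHp : H = ∑ σ, Real.negMulLog (p σ) := by
    refine Finset.sum_congr rfl fun σ _ => ?_
    congr 4
    ext x
    simp [itinBlock, funext_iff]
  have : Nonempty (Fin q → Fin k) := by
    by_contra hne
    rw [not_nonempty_iff] at hne
    simp at hp1
  obtain ⟨w, hw, hw1, hwH⟩ := exists_pos_weights_crossEntropy_le
    (fun σ => measureReal_nonneg) hp1 hρ
  rw [← hHp, ← hpint fun σ => -Real.log (w σ)] at hwH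
  have hU1 := (continuousAt_integral_comp_of_ae_locally_const hBm hBloc
    fun σ => -Real.log (w σ)).eventually_lt_const (show _ < H + 2 * ρ by linarith)
  have hU2 := ((ProbabilityMeasure.continuous_integral_boundedContinuousFunction
    (BoundedContinuousFunction.mkOfCompact ⟨φ, hφ⟩)).tendsto μ).eventually_lt_const
    (show _ < J + ρ from lt_add_of_pos_right J hρ)
  refine ⟨_, hU1.and hU2, q * k ^ q, fun n => ?_⟩
  have hn : (0 : ℝ) < n + 1 := by positivity
  obtain ⟨E, hEG, hEcard, hEcov⟩ := exists_finset_bowenBall_cover (T := T) hqpos hPε hw hw1 (n + 1)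
    ((n + 1) * (H / q + 2 * ρ))
    (G := {x | ∫ y, -Real.log (w (itinBlock T P q y)) ∂(empPM T x n : Measure X) < H + 2 * ρ ∧
      ∫ y, φ y ∂(empPM T x n : Measure X) < J + ρ}) (by
      rintro x ⟨hx, -⟩
      rw [integral_empPM T (fun y => -Real.log (w (itinBlock T P q y))), inv_mul_lt_iff₀ hn] at hx
      refine hx.le.trans ?_
      have : (q : ℝ) * ((n + 1) * (H / q + 2 * ρ)) = (n + 1) * (H + q * (2 * ρ)) := by
        field_simp
      rw [this]
      exact mul_le_mul_of_nonneg_left (by nlinarith) hn.le)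
  refine ⟨E, fun x hx => hEcov x hx, ?_⟩
  have hterm : ∀ e ∈ E, Real.exp (sSup (birkhoffS T φ (n + 1) ''
      bowenBallD (fun a b => dist a b) T e (n + 1) ε)) ≤ Real.exp ((n + 1) * (J + ρ + η)) := by
    intro e he
    have hφe := (hEG he).2
    rw [integral_empPM, inv_mul_lt_iff₀ hn] at hφe
    refine Real.exp_le_exp.2 (csSup_le ⟨_, mem_image_of_mem _ (x := e) fun i _ => ?_⟩ ?_)
    · simpa using hε.le
    · rintro _ ⟨y, hy, rfl⟩
      calc birkhoffS T φ (n + 1) y ≤ ∑ i ∈ Finset.range (n + 1), (φ (T^[i] e) + η) :=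
            Finset.sum_le_sum fun i hi => hosc _ _ (hy i (Finset.mem_range.1 hi))
        _ = ∑ i ∈ Finset.range (n + 1), φ (T^[i] e) + (n + 1) * η := by
            simp [Finset.sum_add_distrib]
        _ ≤ (n + 1) * (J + ρ + η) := by linarith
  calc _ ≤ E.card • Real.exp ((n + 1) * (J + ρ + η)) := Finset.sum_le_card_nsmul _ _ _ hterm
    _ ≤ (q * (k ^ q * Real.exp ((n + 1) * (H / q + 2 * ρ)))) *
          Real.exp ((n + 1) * (J + ρ + η)) := by
        rw [nsmul_eq_mul]
        gcongr
    _ = q * k ^ q * Real.exp ((n + 1) * (H / q + 2 * ρ) + (n + 1) * (J + ρ + η)) := by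
        rw [Real.exp_add]
        ring
    _ ≤ q * k ^ q * Real.exp ((n + 1) * (s + η)) := by
        gcongr
        nlinarith

theorem Finset.sum_biUnion_le_of_nonneg {ι α : Type*} [DecidableEq ι] [DecidableEq α] (F : Finset ι)
    (E : ι → Finset α) {f : α → ℝ} (hf : ∀ a, 0 ≤ f a) :
    ∑ a ∈ F.biUnion E, f a ≤ ∑ i ∈ F, ∑ a ∈ E i, f a := by
  induction F using Finset.induction_on with
  | empty => simp
  | insert i F hi ih =>
    rw [Finset.biUnion_insert, Finset.sum_insert hi]
    have := Finset.sum_union_inter (s₁ := E i) (s₂ := F.biUnion E) (f := f)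
    have := Finset.sum_nonneg (s := E i ∩ F.biUnion E) fun a _ => hf a
    linarith

/-- If `K' ⊆ Y` is closed and `Ξ : M(X) → Y` is continuous, then
`P({x : A(Ξ L_n x) ∩ K' ≠ ∅}, φ) ≤ sup_{y ∈ K'} Λ(y,φ)`. -/
theorem pressure_accPts_image_inter_le_sup_Lam
    {X Y : Type*} [MetricSpace X] [CompactSpace X] [MeasurableSpace X] [BorelSpace X]
    [MetricSpace Y]
    (T : X → X) (hT : Continuous T) (φ : X → ℝ) (hφ : Continuous φ)
    (Ξ : ProbabilityMeasure X → Y) (hΞ : Continuous Ξ)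
    (K' : Set Y) (hK'cl : IsClosed K') :
    pressure T {x : X | ((accPts fun n => Ξ (empPM T x n)) ∩ K').Nonempty} φ ≤
      ⨆ y ∈ K', Lam T Ξ φ y := by
  classical
  set Z := {x : X | ((accPts fun n => Ξ (empPM T x n)) ∩ K').Nonempty}
  refine le_of_forall_gt_imp_ge_of_dense fun c hc => ?_
  obtain ⟨t, hct, htc⟩ := EReal.lt_iff_exists_real_btwn.1 hc
  obtain ⟨s, hcs, hst⟩ := EReal.lt_iff_exists_real_btwn.1 hct
  have hst' : s < t := EReal.coe_lt_coe_iff.1 hst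
  refine le_trans ?_ htc.le
  let K : Set (ProbabilityMeasure X) := {μ | InvMeas T μ} ∩ Ξ ⁻¹' K'
  have hK : IsCompact K := ((isClosed_setOf_invMeas hT).inter (hK'cl.preimage hΞ)).isCompact
  have hKs : ∀ μ ∈ K, ((entropyKS T (μ : Measure X) : ℝ≥0∞) : EReal) +
      ((∫ x, φ x ∂(μ : Measure X) : ℝ) : EReal) < s := by
    intro μ hμ
    have hΛ : ((entropyKS T (μ : Measure X) : ℝ≥0∞) : EReal) +
        ((∫ x, φ x ∂(μ : Measure X) : ℝ) : EReal) ≤ Lam T Ξ φ (Ξ μ) :=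
      le_iSup_of_le μ (le_iSup_of_le ⟨hμ.1, rfl⟩ le_rfl)
    exact (le_iSup₂_of_le (Ξ μ) hμ.2 hΛ).trans_lt hcs
  have hZK : ∀ x ∈ Z, ∃ μ ∈ K, MapClusterPt μ atTop (empPM T x) := by
    rintro x ⟨y, hy, hyK⟩
    obtain ⟨G, hG, hGy⟩ := mapClusterPt_iff_ultrafilter.1 hy
    obtain ⟨μ, -, hμ⟩ := isCompact_univ.ultrafilter_le_nhds (G.map (empPM T x)) (by simp)
    have hμ' : Tendsto (empPM T x) G (𝓝 μ) := hμ
    have hΞμ : Ξ μ = y := tendsto_nhds_unique ((hΞ.tendsto μ).comp hμ') hGy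
    exact ⟨μ, ⟨invMeas_of_tendsto_empPM hT hG hμ', by rwa [mem_preimage, hΞμ]⟩,
      mapClusterPt_iff_ultrafilter.2 ⟨G, hG, hμ'⟩⟩
  obtain ⟨δ, hδ, hδφ⟩ := Metric.uniformContinuous_iff.1
    (CompactSpace.uniformContinuous_of_continuous hφ) ((t - s) / 2) (by linarith)
  refine limsup_le_of_le (by isBoundedDefault) ?_
  filter_upwards [Ioo_mem_nhdsGT hδ] with ε hε
  have hosc : ∀ x y, dist x y ≤ ε → φ y ≤ φ x + (t - s) / 2 := by
    intro x y hxy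
    have := abs_lt.1 (hδφ (hxy.trans_lt hε.2))
    linarith [this.1]
  choose! U hU C E hEcov hEsum using fun (μ : ProbabilityMeasure X) (hμ : μ ∈ K) =>
    exists_nhds_bowenBall_cover hT hφ hμ.1 (hKs μ hμ) hε.1 hosc
  obtain ⟨F, hFK, hF⟩ := hK.elim_nhds_subcover (fun μ => interior (U μ))
    fun μ hμ => interior_mem_nhds.2 (hU μ hμ)
  refine pressAt_le_of_frequently_cover (r := s + (t - s) / 2) (C := ∑ μ ∈ F, C μ) (by linarith)
    (fun n => F.biUnion fun μ => E μ n) ?_ fun n => ?_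
  · intro x hx
    obtain ⟨μ, hμK, hμ⟩ := hZK x hx
    obtain ⟨ν, hν, hμν⟩ := mem_iUnion₂.1 (hF hμK)
    refine (hμ.frequently (mem_interior_iff_mem_nhds.1 hμν)).mono fun n hn => ?_
    obtain ⟨e, he, hxe⟩ := hEcov ν (hFK ν hν) n x hn
    exact ⟨e, Finset.mem_biUnion.2 ⟨ν, hν, he⟩, hxe⟩
  · rw [Finset.sum_mul]
    refine le_trans ?_ (Finset.sum_le_sum fun μ hμ => hEsum μ (hFK μ hμ) n)
    exact Finset.sum_biUnion_le_of_nonneg _ _ fun _ => (Real.exp_pos _).le
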